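/- Let δ > 0, α ∈ ℝ, r ≥ 0 and let ψ be a Schwartz function on ℝ. Then lim_{n→∞} n^{−δ/2 − r} ‖ψ(·/n^δ) cos(n· − α)‖_{H^r} = (1/√2) ‖ψ‖_{L²}, where ψ(·/n^δ) cos(n· − α) denotes the function x ↦ ψ(x/n^δ) cos(nx − α). The same limit holds with cos replaced by sin. -/

import Mathlib

open MeasureTheory Filter Set
open scoped Topology NNReal ENNReal ComplexConjugate

noncomputable section

/-- The (non-normalized) Fourier integral `ĵ(ξ) = ∫ e^{-i x ξ} φ(x) dx`. -/
def nFT (φ : ℝ → ℂ) (ξ : ℝ) : ℂ :=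
  ∫ x : ℝ, Complex.exp (-(Complex.I * ξ * x)) * φ x

/-- The unitary Fourier transform `(2π)^{-1/2} ∫ e^{-i x ξ} φ(x) dx`. -/
def uFT (φ : ℝ → ℂ) (ξ : ℝ) : ℂ :=
  (Real.sqrt (2 * Real.pi) : ℂ)⁻¹ * nFT φ ξ

/-- `g` is (a representative of) the unitary Fourier transform of the real-valued
function `f`, in the sense of tempered distributions. -/
def HasFT (f : ℝ → ℝ) (g : ℝ → ℂ) : Prop :=
  ∀ φ : SchwartzMap ℝ ℂ, ∫ ξ : ℝ, g ξ * φ ξ = ∫ x : ℝ, (f x : ℂ) * uFT (⇑φ) x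

/-- A choice of a Fourier transform representative for `f` (junk value `0` if none exists). -/
def ftOf (f : ℝ → ℝ) : ℝ → ℂ := by
  classical exact if h : ∃ g : ℝ → ℂ, HasFT f g then h.choose else 0

/-- The `H^s(ℝ)` norm: `‖f‖_{H^s}² = ∫ (1+ξ²)^s |f̂(ξ)|² dξ`. -/
def hsNorm (s : ℝ) (f : ℝ → ℝ) : ℝ :=
  (∫ ξ : ℝ, (1 + ξ ^ 2) ^ s * ‖ftOf f ξ‖ ^ 2) ^ (1 / 2 : ℝ)

/-- Membership in the Sobolev space `H^s(ℝ)`. -/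
def MemHs (s : ℝ) (f : ℝ → ℝ) : Prop :=
  (∃ g : ℝ → ℂ, HasFT f g) ∧
    Integrable (fun ξ : ℝ => (1 + ξ ^ 2) ^ s * ‖ftOf f ξ‖ ^ 2)

/-- The `L²(ℝ)` norm. -/
def l2Norm (f : ℝ → ℝ) : ℝ := (∫ x : ℝ, f x ^ 2) ^ (1 / 2 : ℝ)

/-- The `L^∞(ℝ)` norm (essential supremum). -/
def lInfNorm (f : ℝ → ℝ) : ℝ := (eLpNorm f ⊤ volume).toReal

/-- The `W^{1,∞}(ℝ)` norm, `‖f‖_{L^∞} + ‖∂ₓ f‖_{L^∞}`. -/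
def w1InfNorm (f : ℝ → ℝ) : ℝ := lInfNorm f + lInfNorm (deriv f)

/-- `(1-∂ₓ²)⁻¹ f = (1/2) e^{-|·|} ⋆ f`. -/
def helmInv (f : ℝ → ℝ) : ℝ → ℝ :=
  fun x => (1 / 2) * ∫ y : ℝ, Real.exp (-|x - y|) * f y

/-- `F₁(u) = (1-∂ₓ²)⁻¹ ∂ₓ (u^{k+1})`. -/
def F1 (k : ℕ) (u : ℝ → ℝ) : ℝ → ℝ :=
  helmInv (deriv fun x => u x ^ (k + 1))

/-- `F₂(u) = ((2k-1)/2) (1-∂ₓ²)⁻¹ ∂ₓ (u^{k-1} (∂ₓ u)²)`. -/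
def F2 (k : ℕ) (u : ℝ → ℝ) : ℝ → ℝ := fun x =>
  ((2 * (k : ℝ) - 1) / 2) * helmInv (deriv fun y => u y ^ (k - 1) * deriv u y ^ 2) x

/-- `F₃(u) = ((k-1)/2) (1-∂ₓ²)⁻¹ (u^{k-2} (∂ₓ u)³)`; it vanishes when `k = 1`. -/
def F3 (k : ℕ) (u : ℝ → ℝ) : ℝ → ℝ := fun x =>
  (((k : ℝ) - 1) / 2) * helmInv (fun y => u y ^ (k - 2) * deriv u y ^ 3) x

/-- The nonlocal nonlinearity `F(u) = F₁(u) + F₂(u) + F₃(u)`. -/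
def Fnl (k : ℕ) (u : ℝ → ℝ) : ℝ → ℝ := fun x => F1 k u x + F2 k u x + F3 k u x

/-- `j` is an admissible Friedrichs kernel: a Schwartz function whose Fourier transform
`ĵ(ξ) = ∫ e^{-ixξ} j(x) dx` takes real values in `[0,1]` and equals `1` on `[-1,1]`. -/
def MollKernel (j : SchwartzMap ℝ ℝ) : Prop :=
  (∀ ξ : ℝ, ∃ r : ℝ, 0 ≤ r ∧ r ≤ 1 ∧ nFT (fun x => ((j x : ℝ) : ℂ)) ξ = r) ∧
  (∀ ξ : ℝ, |ξ| ≤ 1 → nFT (fun x => ((j x : ℝ) : ℂ)) ξ = 1)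

/-- The Friedrichs mollifier `J_ε f = j_ε ⋆ f`, where `j_ε = ε⁻¹ j(·/ε)`. -/
def Jmol (j : ℝ → ℝ) (ε : ℝ) (f : ℝ → ℝ) : ℝ → ℝ :=
  fun x => ∫ y : ℝ, ε⁻¹ * j ((x - y) / ε) * f y

/-- The pairing `(D^s f, D^s g)_{L²} = ∫ (1+ξ²)^s f̂(ξ) conj(ĝ(ξ)) dξ` (via Plancherel). -/
def dsPair (s : ℝ) (f g : ℝ → ℝ) : ℝ :=
  (∫ ξ : ℝ, (((1 + ξ ^ 2) ^ s : ℝ) : ℂ) * ftOf f ξ * conj (ftOf g ξ)).re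

/-- `h = D^s f`, where `D^s = (1-∂ₓ²)^{s/2}` is the Fourier multiplier `(1+ξ²)^{s/2}`. -/
def IsDs (s : ℝ) (f h : ℝ → ℝ) : Prop :=
  HasFT h fun ξ => (((1 + ξ ^ 2) ^ (s / 2) : ℝ) : ℂ) * ftOf f ξ

/-- `h = D^η ∂ₓ f`, the Fourier multiplier `(1+ξ²)^{η/2} (iξ)`. -/
def IsDsDx (η : ℝ) (f h : ℝ → ℝ) : Prop :=
  HasFT h fun ξ => (((1 + ξ ^ 2) ^ (η / 2) : ℝ) : ℂ) * (Complex.I * ξ) * ftOf f ξ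

/-- `h = ∂ₓ f`, the Fourier multiplier `iξ`. -/
def IsDx (f h : ℝ → ℝ) : Prop :=
  HasFT h fun ξ => Complex.I * ξ * ftOf f ξ

/-- Continuity in time with values in `H^s`. -/
def HsContinuousOn (s : ℝ) (u : ℝ → ℝ → ℝ) (I : Set ℝ) : Prop :=
  ∀ t₀ ∈ I, Tendsto (fun t => hsNorm s fun x => u t x - u t₀ x) (𝓝[I] t₀) (𝓝 0)

/-- `v` is the time derivative of `u` in the `H^s`-valued sense. -/
def HsDerivOn (s : ℝ) (u v : ℝ → ℝ → ℝ) (I : Set ℝ) : Prop :=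
  ∀ t₀ ∈ I,
    Tendsto (fun t => hsNorm s fun x => (u t x - u t₀ x) / (t - t₀) - v t₀ x)
      (𝓝[I \ {t₀}] t₀) (𝓝 0)

/-- `u` is a solution on `[0,T]` of `∂ₜ u + u^k ∂ₓ u + F(u) = 0` with datum `u₀`:
a continuous `H^s`-valued map satisfying the corresponding integral equation. -/
def IsSolutionOn (k : ℕ) (s T : ℝ) (u₀ : ℝ → ℝ) (u : ℝ → ℝ → ℝ) : Prop :=
  (∀ t ∈ Icc (0 : ℝ) T, MemHs s (u t)) ∧
  HsContinuousOn s u (Icc 0 T) ∧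
  (∀ x : ℝ, u 0 x = u₀ x) ∧
  ∀ t ∈ Icc (0 : ℝ) T, ∀ x : ℝ,
    u t x = u₀ x - ∫ τ in (0 : ℝ)..t, (u τ x ^ k * deriv (u τ) x + Fnl k (u τ) x)

lemma hfn_locInt {g : ℝ → ℂ} (h : ∀ φ : SchwartzMap ℝ ℂ, Integrable (fun ξ => g ξ * φ ξ)) :
    LocallyIntegrable g := by
  intro x
  let b : ContDiffBump x := ⟨1, 2, by norm_num, by norm_num⟩
  have hc : HasCompactSupport (fun y => ((b y : ℝ) : ℂ)) :=
    b.hasCompactSupport.comp_left (g := fun t : ℝ => (t : ℂ)) (by simp)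
  have hs : ContDiff ℝ (⊤ : ℕ∞) (fun y => ((b y : ℝ) : ℂ)) :=
    Complex.ofRealCLM.contDiff.comp b.contDiff
  refine ⟨Metric.ball x 1, Metric.ball_mem_nhds x one_pos, ?_⟩
  have h1 := (h (hc.toSchwartzMap hs)).integrableOn (s := Metric.ball x 1)
  refine h1.congr_fun (fun y hy => ?_) measurableSet_ball
  have : b y = 1 := b.one_of_mem_closedBall (Metric.ball_subset_closedBall hy)
  simp [this]

lemma hfn_ae_eq {g G : ℝ → ℂ} (hg : LocallyIntegrable g) (hG : LocallyIntegrable G)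
    (h : ∀ φ : SchwartzMap ℝ ℂ, ∫ ξ, g ξ * φ ξ = ∫ ξ, G ξ * φ ξ) : g =ᵐ[volume] G := by
  refine ae_eq_of_integral_contDiff_smul_eq hg hG (fun b hb hbc => ?_)
  have hc : HasCompactSupport (fun y => ((b y : ℝ) : ℂ)) :=
    hbc.comp_left (g := fun t : ℝ => (t : ℂ)) (by simp)
  have hs : ContDiff ℝ (⊤ : ℕ∞) (fun y => ((b y : ℝ) : ℂ)) :=
    Complex.ofRealCLM.contDiff.comp hb
  simpa [mul_comm] using h (hc.toSchwartzMap hs)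

lemma hfn_unique {f : ℝ → ℝ} {g G : ℝ → ℂ} (hG : ∀ φ : SchwartzMap ℝ ℂ,
    Integrable (fun ξ => G ξ * φ ξ)) (hfG : HasFT f G) (hfg : HasFT f g)
    (h0 : ¬ G =ᵐ[volume] 0) : g =ᵐ[volume] G := by
  have hGl := hfn_locInt hG
  have he : ∀ φ : SchwartzMap ℝ ℂ, ∫ ξ, g ξ * φ ξ = ∫ ξ, G ξ * φ ξ := fun φ => by
    rw [hfG φ, hfg φ]
  obtain ⟨φ₁, h1⟩ : ∃ φ : SchwartzMap ℝ ℂ, ∫ ξ, G ξ * φ ξ ≠ 0 := by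
    by_contra! hcon
    exact h0 (hfn_ae_eq hGl (locallyIntegrable_const 0) (fun φ => by simp [hcon φ]))
  have key : ∀ φ : SchwartzMap ℝ ℂ, ∫ ξ, G ξ * φ ξ ≠ 0 → Integrable (fun ξ => g ξ * φ ξ) := by
    intro φ hφ
    by_contra hn
    exact hφ (by rw [← he φ, integral_undef hn])
  refine hfn_ae_eq (hfn_locInt fun φ => ?_) hGl he
  by_cases hφ : ∫ ξ, G ξ * φ ξ = 0
  · have h2 : ∫ ξ, G ξ * (φ + φ₁) ξ ≠ 0 := by
      simp only [add_apply, mul_add]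
      rw [integral_add (hG φ) (hG φ₁), hφ, zero_add]
      exact h1
    have := (key _ h2).sub (key _ h1)
    refine this.congr (Eventually.of_forall fun ξ => ?_)
    simp [mul_add]
  · exact key _ hφ

lemma hfn_hsNorm {f : ℝ → ℝ} {G : ℝ → ℂ} (s : ℝ) (hG : ∀ φ : SchwartzMap ℝ ℂ,
    Integrable (fun ξ => G ξ * φ ξ)) (hfG : HasFT f G)
    (h0 : ¬ G =ᵐ[volume] 0) :
    hsNorm s f = (∫ ξ : ℝ, (1 + ξ ^ 2) ^ s * ‖G ξ‖ ^ 2) ^ (1 / 2 : ℝ) := by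
  have hex : ∃ g : ℝ → ℂ, HasFT f g := ⟨G, hfG⟩
  have : HasFT f (ftOf f) := by
    unfold ftOf
    rw [dif_pos hex]
    exact hex.choose_spec
  have hae := hfn_unique hG hfG this h0
  unfold hsNorm
  congr 1
  apply integral_congr_ae
  filter_upwards [hae] with ξ hξ
  rw [hξ]

lemma hfn_nFT_eq (φ : ℝ → ℂ) (ξ : ℝ) :
    nFT φ ξ = FourierTransform.fourier φ ((2 * Real.pi)⁻¹ * ξ) := by
  rw [Real.fourier_real_eq_integral_exp_smul]
  unfold nFT
  congr 1
  ext x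
  rw [smul_eq_mul]
  congr 2
  have : (Real.pi : ℂ) ≠ 0 := by exact_mod_cast Real.pi_ne_zero
  push_cast
  field_simp

lemma hfn_hasFT {f : ℝ → ℝ} (hf : Integrable f) : HasFT f (uFT fun x => (f x : ℂ)) := by
  intro φ
  let L : ℝ →ₗ[ℝ] ℝ →ₗ[ℝ] ℝ := (2 * Real.pi)⁻¹ • LinearMap.mul ℝ ℝ
  have hL : Continuous fun p : ℝ × ℝ ↦ L p.1 p.2 := by
    simp [L]; fun_prop
  have hfl : L.flip = L := by ext; simp [L]
  have hn : ∀ φ : ℝ → ℂ, ∀ ξ, nFT φ ξ = VectorFourier.fourierIntegral Real.fourierChar volume L φ ξ := by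
    intro φ ξ
    rw [hfn_nFT_eq, Real.fourier_real_eq]
    unfold VectorFourier.fourierIntegral
    congr 1
    ext x
    simp only [L, LinearMap.smul_apply, LinearMap.mul_apply', smul_eq_mul]
    congr 3
    ring
  have := VectorFourier.integral_fourierIntegral_smul_eq_flip (μ := volume) (ν := volume) (L := L)
    Real.continuous_fourierChar hL hf.ofReal (φ.integrable (μ := volume)) (𝕜 := ℝ)
  rw [hfl] at this
  simp only [uFT, hn, smul_eq_mul] at this ⊢
  simp only [mul_assoc, mul_left_comm _ ((Real.sqrt (2 * Real.pi) : ℂ)⁻¹) _]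
  rw [integral_const_mul, integral_const_mul]
  congr 1

lemma hfn_schwartz (ψ : SchwartzMap ℝ ℝ) : ∃ Ψ : SchwartzMap ℝ ℂ,
    (∀ ξ, Ψ ξ = uFT (fun x => (ψ x : ℂ)) ξ) ∧ ∫ ξ, ‖Ψ ξ‖ ^ 2 = ∫ x, ψ x ^ 2 := by
  let ψc : SchwartzMap ℝ ℂ := SchwartzMap.postcompCLM (𝕜 := ℝ) Complex.ofRealCLM ψ
  have hpi : (2 * Real.pi)⁻¹ ≠ 0 := by positivity
  let e : ℝ ≃L[ℝ] ℝ := ContinuousLinearEquiv.unitsEquivAut ℝ (Units.mk0 _ hpi)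
  let P : SchwartzMap ℝ ℂ := FourierTransform.fourier ψc
  refine ⟨((Real.sqrt (2 * Real.pi) : ℂ)⁻¹) • SchwartzMap.compCLMOfContinuousLinearEquiv ℂ e P, ?_, ?_⟩
  · intro ξ
    simp only [uFT, hfn_nFT_eq]
    simp [P, SchwartzMap.fourier_coe, e, mul_comm]
    left
    rfl
  · have h1 : ∫ ξ, ‖P ξ‖ ^ 2 = ∫ x, ‖ψc x‖ ^ 2 := SchwartzMap.integral_norm_sq_fourier ψc
    have h2 := Measure.integral_comp_mul_right (fun ξ => ‖P ξ‖ ^ 2) (2 * Real.pi)⁻¹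
    have h3 : ∫ x, ‖ψc x‖ ^ 2 = ∫ x, ψ x ^ 2 := by
      congr 1; ext x; simp [ψc]
    rw [h1, h3] at h2
    simp only [smul_apply, norm_smul, mul_pow]
    rw [integral_const_mul]
    have h4 : ∀ ξ, SchwartzMap.compCLMOfContinuousLinearEquiv ℂ e P ξ = P (ξ * (2 * Real.pi)⁻¹) := by
      intro ξ; simp [e]
    simp only [h4]
    rw [h2]
    have hp : (0:ℝ) < 2 * Real.pi := by positivity
    rw [norm_inv, Complex.norm_real, Real.norm_of_nonneg (Real.sqrt_nonneg _), inv_pow,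
      Real.sq_sqrt hp.le, inv_inv, abs_of_pos hp, smul_eq_mul, ← mul_assoc, inv_mul_cancel₀ hp.ne', one_mul]

/-- The rescaled Sobolev weight. -/
def hfnW (r a N η : ℝ) : ℝ := ((1 + (a + η / N) ^ 2) / a ^ 2) ^ r

lemma hfnW_nonneg (r a N η : ℝ) : 0 ≤ hfnW r a N η := by
  unfold hfnW; positivity

lemma hfnW_le {r a N : ℝ} (hr : 0 ≤ r) (ha : 1 ≤ a) (hN : 1 ≤ N) (η : ℝ) :
    hfnW r a N η ≤ 3 ^ ⌈r⌉₊ * (1 + η ^ 2) ^ ⌈r⌉₊ := by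
  have h1 : (1 + (a + η / N) ^ 2) / a ^ 2 ≤ 3 * (1 + η ^ 2) := by
    rw [div_le_iff₀ (by positivity)]
    have ht : (η / N) ^ 2 ≤ η ^ 2 := by
      rw [div_pow]
      exact div_le_self (sq_nonneg _) (by nlinarith)
    have ha2 : 1 ≤ a ^ 2 := by nlinarith
    nlinarith [sq_nonneg (a - η / N), mul_nonneg (sub_nonneg.2 ha2) (sq_nonneg η)]
  have h2 : 1 ≤ 3 * (1 + η ^ 2) := by nlinarith [sq_nonneg η]
  unfold hfnW
  calc _ ≤ (3 * (1 + η ^ 2)) ^ r := Real.rpow_le_rpow (by positivity) h1 hr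
    _ ≤ (3 * (1 + η ^ 2)) ^ ((⌈r⌉₊ : ℕ) : ℝ) := Real.rpow_le_rpow_of_exponent_le h2 (Nat.le_ceil r)
    _ = _ := by rw [Real.rpow_natCast, mul_pow]

lemma hfnW_cont {r a N : ℝ} (hr : 0 ≤ r) : Continuous (hfnW r a N) := by
  unfold hfnW
  exact Continuous.rpow_const (by fun_prop) (fun _ => Or.inr hr)

lemma hfn_poly (Φ : SchwartzMap ℝ ℂ) (m : ℕ) (C : ℝ) :
    Integrable (fun η : ℝ => 3 ^ m * (1 + η ^ 2) ^ m * (C * ‖Φ η‖)) := by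
  have h1 := Φ.integrable_pow_mul volume (2 * m)
  have h0 := Φ.integrable_pow_mul volume 0
  have h := ((h0.add h1).const_mul (3 ^ m * 2 ^ (m - 1) * |C|))
  refine h.mono' (by have := Φ.continuous; fun_prop) (Eventually.of_forall fun η => ?_)
  have := add_pow_le (zero_le_one) (sq_nonneg η) m
  rw [Real.norm_eq_abs, abs_mul, abs_mul C,
    abs_of_nonneg (by positivity : (0:ℝ) ≤ 3 ^ m * (1 + η ^ 2) ^ m), abs_norm]
  simp only [Pi.add_apply, pow_mul, Real.norm_eq_abs, sq_abs, pow_zero, one_mul]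
  calc _ ≤ 3 ^ m * (2 ^ (m - 1) * (1 ^ m + (η ^ 2) ^ m)) * (|C| * ‖Φ η‖) := by gcongr
    _ = _ := by rw [one_pow]; ring

lemma hfnW_int {r a N : ℝ} (hr : 0 ≤ r) (ha : 1 ≤ a) (hN : 1 ≤ N) {k : ℝ → ℝ}
    (hk : Continuous k) {Φ : SchwartzMap ℝ ℂ} {C : ℝ} (hb : ∀ η, |k η| ≤ C * ‖Φ η‖) :
    Integrable (fun η => hfnW r a N η * k η) := by
  refine (hfn_poly Φ ⌈r⌉₊ C).mono' ((hfnW_cont hr).mul hk).aestronglyMeasurable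
    (Eventually.of_forall fun η => ?_)
  rw [norm_mul, Real.norm_of_nonneg (hfnW_nonneg _ _ _ _), Real.norm_eq_abs]
  exact mul_le_mul (hfnW_le hr ha hN η) (hb η) (abs_nonneg _) (by positivity)

lemma hfnW_tendsto {δ : ℝ} (hδ : 0 < δ) (r η : ℝ) :
    Tendsto (fun n : ℕ => hfnW r n ((n : ℝ) ^ δ) η) atTop (𝓝 1) := by
  have hc : Tendsto (fun n : ℕ => (n : ℝ)) atTop atTop := tendsto_natCast_atTop_atTop
  have hi : Tendsto (fun n : ℕ => ((n : ℝ))⁻¹) atTop (𝓝 0) := tendsto_inv_atTop_zero.comp hc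
  have hN : Tendsto (fun n : ℕ => ((n : ℝ) ^ δ)⁻¹) atTop (𝓝 0) :=
    tendsto_inv_atTop_zero.comp ((tendsto_rpow_atTop hδ).comp hc)
  have h1 : Tendsto (fun n : ℕ => ((n : ℝ))⁻¹ ^ 2 + (1 + η * ((n : ℝ) ^ δ)⁻¹ * (n : ℝ)⁻¹) ^ 2) atTop
      (𝓝 (0 ^ 2 + (1 + η * 0 * 0) ^ 2)) :=
    (hi.pow 2).add ((tendsto_const_nhds.add ((hN.const_mul η).mul hi)).pow 2)
  have h2 := h1.rpow_const (p := r) (Or.inl (by norm_num))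
  have h3 : ((0:ℝ) ^ 2 + (1 + η * 0 * 0) ^ 2) ^ r = 1 := by norm_num
  rw [h3] at h2
  refine h2.congr' ?_
  filter_upwards [eventually_ge_atTop 1] with n hn
  have hn0 : (n : ℝ) ≠ 0 := by positivity
  unfold hfnW
  congr 1
  field_simp
  

lemma hfn_dct {δ : ℝ} (hδ : 0 < δ) {r : ℝ} (hr : 0 ≤ r) {k : ℕ → ℝ → ℝ} {kl : ℝ → ℝ}
    (hk : ∀ n, Continuous (k n)) {Φ : SchwartzMap ℝ ℂ} {C : ℝ} (hb : ∀ n η, |k n η| ≤ C * ‖Φ η‖)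
    (hl : ∀ η, Tendsto (fun n => k n η) atTop (𝓝 (kl η))) :
    Tendsto (fun n : ℕ => ∫ η, hfnW r n ((n : ℝ) ^ δ) η * k n η) atTop (𝓝 (∫ η, kl η)) := by
  refine tendsto_integral_filter_of_dominated_convergence
    (fun η : ℝ => 3 ^ ⌈r⌉₊ * (1 + η ^ 2) ^ ⌈r⌉₊ * (C * ‖Φ η‖)) ?_ ?_ (hfn_poly Φ _ C) ?_
  · exact Eventually.of_forall fun n => ((hfnW_cont hr).mul (hk n)).aestronglyMeasurable
  · filter_upwards [eventually_ge_atTop 1] with n hn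
    refine Eventually.of_forall fun η => ?_
    have ha : (1:ℝ) ≤ n := by exact_mod_cast hn
    rw [norm_mul, Real.norm_of_nonneg (hfnW_nonneg _ _ _ _), Real.norm_eq_abs]
    exact mul_le_mul (hfnW_le hr ha (Real.one_le_rpow ha hδ.le) η) (hb n η) (abs_nonneg _)
      (by positivity)
  · refine Eventually.of_forall fun η => ?_
    simpa using (hfnW_tendsto hδ r η).mul (hl η)

lemma hfn_subst {r a N : ℝ} (ha : 0 < a) (hN : 0 < N) (k : ℝ → ℝ) (ξ : ℝ) :
    (1 + ξ ^ 2) ^ r * k (N * (ξ - a)) =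
      a ^ (2 * r) * (fun η => hfnW r a N η * k η) (N * (ξ - a)) := by
  have h : (1 + ξ ^ 2) ^ r = a ^ (2 * r) * hfnW r a N (N * (ξ - a)) := by
    unfold hfnW
    rw [Real.rpow_mul ha.le, Real.rpow_two, ← Real.mul_rpow (by positivity) (by positivity)]
    congr 1
    field_simp
    ring
  rw [h]; ring

lemma hfn_subst_int {r a N : ℝ} (hr : 0 ≤ r) (ha : 1 ≤ a) (hN : 1 ≤ N) {k : ℝ → ℝ}
    (hk : Continuous k) {Φ : SchwartzMap ℝ ℂ} {C : ℝ} (hb : ∀ η, |k η| ≤ C * ‖Φ η‖) :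
    Integrable (fun ξ : ℝ => (1 + ξ ^ 2) ^ r * k (N * (ξ - a))) := by
  have ha0 : 0 < a := by linarith
  have hN0 : 0 < N := by linarith
  simp only [hfn_subst ha0 hN0]
  exact (((hfnW_int hr ha hN hk hb).comp_mul_left' hN0.ne').comp_sub_right a).const_mul _

lemma hfn_subst_integral {r a N : ℝ} (ha : 0 < a) (hN : 0 < N) (k : ℝ → ℝ) :
    ∫ ξ : ℝ, (1 + ξ ^ 2) ^ r * k (N * (ξ - a)) =
      a ^ (2 * r) * (N⁻¹ * ∫ η, hfnW r a N η * k η) := by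
  simp only [hfn_subst ha hN]
  rw [integral_const_mul,
    integral_sub_right_eq_self (fun ξ => (fun η => hfnW r a N η * k η) (N * ξ)) a,
    Measure.integral_comp_mul_left (fun η => hfnW r a N η * k η) N, abs_of_pos (inv_pos.2 hN), smul_eq_mul]

/-- The explicit Fourier transform of the wave packet. -/
def hfnG (Ψ : ℝ → ℂ) (a N α ξ : ℝ) : ℂ :=
  (N / 2 : ℂ) * (Complex.exp (-(Complex.I * α)) * Ψ (N * (ξ - a)) +
    Complex.exp (Complex.I * α) * Ψ (N * (ξ + a)))

lemma hfn_uFT (ψ : SchwartzMap ℝ ℝ) {a N : ℝ} (hN : 0 < N) (α ξ : ℝ) :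
    uFT (fun x => ((ψ (x / N) * Real.cos (a * x - α) : ℝ) : ℂ)) ξ =
      hfnG (uFT fun x => (ψ x : ℂ)) a N α ξ := by
  have hIntg : ∀ t : ℝ, Integrable (fun x : ℝ => Complex.exp (-(Complex.I * t * x)) * (ψ x : ℂ)) := by
    intro t
    have hi : Integrable (fun x => (ψ x : ℂ)) := (ψ.integrable (μ := volume)).ofReal
    refine hi.bdd_mul (c := 1) (by fun_prop) (Eventually.of_forall fun x => ?_)
    rw [show -(Complex.I * t * x) = ((-(t * x) : ℝ) : ℂ) * Complex.I by push_cast; ring,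
      Complex.norm_exp_ofReal_mul_I]
  have hmain : nFT (fun x => ((ψ (x / N) * Real.cos (a * x - α) : ℝ) : ℂ)) ξ =
      hfnG (nFT fun x => (ψ x : ℂ)) a N α ξ := by
    unfold nFT hfnG
    have h := Measure.integral_comp_div (fun y : ℝ => Complex.exp (-(Complex.I * ξ * (N * y))) *
      ((ψ y * Real.cos (a * (N * y) - α) : ℝ) : ℂ)) N
    have e1 : ∀ x : ℝ, N * (x / N) = x := fun x => by field_simp
    have e2 : ∀ x : ℝ, (N : ℂ) * ((x / N : ℝ) : ℂ) = x := fun x => by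
      rw [← Complex.ofReal_mul, e1]
    simp only [e1, e2] at h
    rw [h, abs_of_pos hN, ← integral_const_mul, ← integral_const_mul,
      ← integral_add ((hIntg _).const_mul _) ((hIntg _).const_mul _), ← integral_const_mul,
      ← integral_smul]
    congr 1
    ext y
    rw [Complex.real_smul]
    push_cast
    rw [Complex.cos]
    have a1 : Complex.exp (-(Complex.I * ξ * (N * y))) * Complex.exp ((a * (N * y) - α) * Complex.I)
      = Complex.exp (-(Complex.I * α)) * Complex.exp (-(Complex.I * (N * (ξ - a)) * y)) := by
      rw [← Complex.exp_add, ← Complex.exp_add]; congr 1; ring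
    have a2 : Complex.exp (-(Complex.I * ξ * (N * y))) * Complex.exp (-(a * (N * y) - α) * Complex.I)
      = Complex.exp ((Complex.I * α)) * Complex.exp (-(Complex.I * (N * (ξ + a)) * y)) := by
      rw [← Complex.exp_add, ← Complex.exp_add]; congr 1; ring
    linear_combination ((N : ℂ) * ψ y / 2) * (a1 + a2)
  unfold uFT
  rw [hmain]
  unfold hfnG
  ring

lemma hfn_normG (Ψ : ℝ → ℂ) (a N α ξ : ℝ) :
    ‖hfnG Ψ a N α ξ‖ ^ 2 = N ^ 2 / 4 * (‖Ψ (N * (ξ - a))‖ ^ 2 + ‖Ψ (N * (ξ + a))‖ ^ 2 +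
      2 * (Complex.exp (-(Complex.I * α)) * Ψ (N * (ξ - a)) *
        conj (Complex.exp (Complex.I * α) * Ψ (N * (ξ + a)))).re) := by
  unfold hfnG
  have n1 : ‖Complex.exp (Complex.I * α)‖ = 1 := by
    rw [mul_comm, Complex.norm_exp_ofReal_mul_I]
  have n2 : ‖Complex.exp (-(Complex.I * α))‖ = 1 := by
    rw [Complex.exp_neg, norm_inv, n1, inv_one]
  rw [norm_mul, mul_pow, Complex.sq_norm (_ + _), Complex.normSq_add, ← Complex.sq_norm,
    ← Complex.sq_norm, norm_mul, norm_mul, n1, n2, one_mul, one_mul]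
  congr 1
  rw [norm_div, Complex.norm_real, div_pow, Real.norm_eq_abs, sq_abs]
  norm_num

lemma hfn_bound (Ψ : SchwartzMap ℝ ℂ) : ∃ C, 0 ≤ C ∧ ∀ η, ‖Ψ η‖ ≤ C := by
  refine ⟨‖Ψ.toBoundedContinuousFunction‖, norm_nonneg _, fun η => ?_⟩
  exact Ψ.toBoundedContinuousFunction.norm_coe_le_norm η

lemma hfn_limit {δ : ℝ} (hδ : 0 < δ) {r : ℝ} (hr : 0 ≤ r) (α : ℝ) (Ψ : SchwartzMap ℝ ℂ) :
    Tendsto (fun n : ℕ => (n : ℝ) ^ (-δ - 2 * r) *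
      ∫ ξ : ℝ, (1 + ξ ^ 2) ^ r * ‖hfnG Ψ n ((n : ℝ) ^ δ) α ξ‖ ^ 2) atTop
      (𝓝 ((∫ ξ, ‖Ψ ξ‖ ^ 2) / 2)) := by
  obtain ⟨C, hC, hb⟩ := hfn_bound Ψ
  have hcont := Ψ.continuous
  let Φ : SchwartzMap ℝ ℂ := SchwartzMap.compCLMOfContinuousLinearEquiv ℂ
    (ContinuousLinearEquiv.neg ℝ) Ψ
  have hΦ : ∀ η, Φ η = Ψ (-η) := fun η => by simp [Φ]
  let k1 : ℝ → ℝ := fun η => ‖Ψ η‖ ^ 2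
  let k2 : ℝ → ℝ := fun η => ‖Ψ (-η)‖ ^ 2
  let k3 : ℕ → ℝ → ℝ := fun n η => (Complex.exp (-(Complex.I * α)) * Ψ η *
        conj (Complex.exp (Complex.I * α) * Ψ (η + 2 * (n : ℝ) ^ δ * n))).re
  have n1 : ‖Complex.exp (Complex.I * α)‖ = 1 := by
    rw [mul_comm, Complex.norm_exp_ofReal_mul_I]
  have n2 : ‖Complex.exp (-(Complex.I * α))‖ = 1 := by
    rw [Complex.exp_neg, norm_inv, n1, inv_one]
  have c1 : Continuous k1 := by fun_prop
  have c2 : Continuous k2 := by fun_prop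
  have c3 : ∀ n, Continuous (k3 n) := fun n => by
    apply Complex.continuous_re.comp
    apply Continuous.mul (by fun_prop)
    exact Complex.continuous_conj.comp (by fun_prop)
  have b1 : ∀ η, |k1 η| ≤ C * ‖Ψ η‖ := fun η => by
    simp only [k1]; rw [abs_of_nonneg (by positivity), sq]; gcongr; exact hb η
  have b2 : ∀ η, |k2 η| ≤ C * ‖Φ η‖ := fun η => by
    simp only [k2]; rw [abs_of_nonneg (by positivity), sq, hΦ]; gcongr; exact hb _
  have b3' : ∀ n η, |k3 n η| ≤ ‖Ψ (η + 2 * (n : ℝ) ^ δ * n)‖ * ‖Ψ η‖ := fun n η => by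
    refine (Complex.abs_re_le_norm _).trans ?_
    rw [norm_mul, norm_mul, Complex.norm_conj, norm_mul, n1, n2, one_mul, one_mul, mul_comm]
  have b3 : ∀ n η, |k3 n η| ≤ C * ‖Ψ η‖ := fun n η => by
    refine (b3' n η).trans ?_
    gcongr; exact hb _
  have hc : Tendsto (fun n : ℕ => (n : ℝ)) atTop atTop := tendsto_natCast_atTop_atTop
  have l3 : ∀ η, Tendsto (fun n => k3 n η) atTop (𝓝 ((fun _ => (0:ℝ)) η)) := fun η => by
    have hz : Tendsto Ψ atTop (𝓝 0) :=
      (Ψ.toZeroAtInfty.zero_at_infty').mono_left atTop_le_cocompact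
    have ht : Tendsto (fun n : ℕ => η + 2 * (n : ℝ) ^ δ * n) atTop atTop := by
      apply tendsto_atTop_add_const_left
      exact (((tendsto_rpow_atTop hδ).comp hc).const_mul_atTop two_pos).atTop_mul_atTop₀ hc
    have h := ((hz.comp ht).norm).mul_const ‖Ψ η‖
    rw [norm_zero, zero_mul] at h
    exact squeeze_zero_norm (fun n => b3' n η) h
  have t1 := hfn_dct hδ hr (k := fun _ => k1) (fun _ => c1) (fun _ => b1)
    (fun η => tendsto_const_nhds)
  have t2 := hfn_dct hδ hr (k := fun _ => k2) (fun _ => c2) (fun _ => b2)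
    (fun η => tendsto_const_nhds)
  have t3 := hfn_dct hδ hr c3 b3 l3
  have e2 : ∫ η, k2 η = ∫ η, ‖Ψ η‖ ^ 2 := integral_neg_eq_self (fun η => ‖Ψ η‖ ^ 2) volume
  rw [e2] at t2
  have t := ((t1.add t2).add (t3.const_mul 2)).const_mul (1 / 4)
  rw [integral_zero] at t
  have hv : (1 / 4 : ℝ) * ((∫ η, k1 η) + (∫ η, ‖Ψ η‖ ^ 2) + 2 * 0) = (∫ ξ, ‖Ψ ξ‖ ^ 2) / 2 := by
    simp only [k1]; ring
  rw [hv] at t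
  refine t.congr' ?_
  filter_upwards [eventually_ge_atTop 1] with n hn
  have ha : (1:ℝ) ≤ n := by exact_mod_cast hn
  have ha0 : (0:ℝ) < n := by linarith
  have hN : 1 ≤ (n : ℝ) ^ δ := Real.one_le_rpow ha hδ.le
  have hN0 : 0 < (n : ℝ) ^ δ := by linarith
  have hpow : (n : ℝ) ^ (-δ - 2 * r) = ((n : ℝ) ^ δ)⁻¹ * ((n : ℝ) ^ (2 * r))⁻¹ := by
    rw [sub_eq_add_neg, Real.rpow_add ha0, Real.rpow_neg ha0.le, Real.rpow_neg ha0.le]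
  have hM0 : 0 < (n : ℝ) ^ (2 * r) := by positivity
  have i1 := hfn_subst_int hr ha hN c1 b1
  have i2 := hfn_subst_int hr ha hN c2 b2
  have i3 := hfn_subst_int hr ha hN (c3 n) (b3 n)
  have s1 := hfn_subst_integral (r := r) ha0 hN0 k1
  have s2 := hfn_subst_integral (r := r) ha0 hN0 k2
  have s3 := hfn_subst_integral (r := r) ha0 hN0 (k3 n)
  have i2' := i2.comp_neg
  rw [← integral_neg_eq_self] at s2
  rw [hpow]
  generalize (n : ℝ) ^ (2 * r) = M at *
  have hIntg : ∫ ξ : ℝ, (1 + ξ ^ 2) ^ r * ‖hfnG Ψ n ((n : ℝ) ^ δ) α ξ‖ ^ 2 =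
      ((n : ℝ) ^ δ) ^ 2 / 4 * ((∫ ξ : ℝ, (1 + ξ ^ 2) ^ r * k1 ((n : ℝ) ^ δ * (ξ - n))) +
      (∫ ξ : ℝ, (1 + (-ξ) ^ 2) ^ r * k2 ((n : ℝ) ^ δ * (-ξ - n))) +
      2 * ∫ ξ : ℝ, (1 + ξ ^ 2) ^ r * k3 n ((n : ℝ) ^ δ * (ξ - n))) := by
    have j := integral_add (i1.add i2') (i3.const_mul 2)
    simp only [Pi.add_apply] at j
    rw [integral_add i1 i2', integral_const_mul] at j
    rw [← j, ← integral_const_mul]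
    congr 1
    ext ξ
    rw [hfn_normG]
    simp only [k1, k2, k3]
    rw [show -((n : ℝ) ^ δ * (-ξ - n)) = (n : ℝ) ^ δ * (ξ + n) by ring,
      show (n : ℝ) ^ δ * (ξ - n) + 2 * (n : ℝ) ^ δ * n = (n : ℝ) ^ δ * (ξ + n) by ring, neg_sq]
    ring
  rw [hIntg, s1, s2, s3]
  field_simp

lemma hfn_cos (δ : ℝ) (hδ : 0 < δ) (α r : ℝ) (hr : 0 ≤ r) (ψ : SchwartzMap ℝ ℝ) :
    Tendsto (fun n : ℕ => (n : ℝ) ^ (-(δ / 2) - r) *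
        hsNorm r fun x => ψ (x / (n : ℝ) ^ δ) * Real.cos ((n : ℝ) * x - α))
      atTop (𝓝 ((1 / Real.sqrt 2) * l2Norm ⇑ψ)) := by
  obtain ⟨Ψ, hΨ, hS⟩ := hfn_schwartz ψ
  have hΨ' : (uFT fun x => (ψ x : ℂ)) = Ψ := (funext hΨ).symm
  have hc : Tendsto (fun n : ℕ => (n : ℝ)) atTop atTop := tendsto_natCast_atTop_atTop
  by_cases h0 : ψ = 0
  · subst h0
    have h1 : Tendsto (fun n : ℕ => (n : ℝ) ^ (-(δ / 2) - r)) atTop (𝓝 0) := by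
      rw [← neg_add']
      exact (tendsto_rpow_neg_atTop (by positivity)).comp hc
    have h2 := h1.mul_const (hsNorm r fun _ => 0)
    simpa [l2Norm, Real.zero_rpow] using h2
  have hlim := hfn_limit hδ hr α Ψ
  rw [hS] at hlim
  have hpos : 0 < ∫ x, ψ x ^ 2 := by
    have hnn : 0 ≤ ∫ x, ψ x ^ 2 := integral_nonneg fun x => sq_nonneg _
    refine lt_of_le_of_ne hnn fun he => h0 ?_
    have hi : Integrable (fun x => ψ x ^ 2) := by
      have := (ψ.memLp 2 volume).integrable_sq
      exact this
    have := (integral_eq_zero_iff_of_nonneg (fun x => sq_nonneg _) hi).1 he.symm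
    have h3 : (fun x => ψ x ^ 2) = 0 :=
      (Continuous.ae_eq_iff_eq volume (ψ.continuous.pow 2) continuous_zero).1 this
    ext x
    have := congrFun h3 x
    simpa using this
  have hev := hlim.eventually (lt_mem_nhds (half_pos hpos))
  have hfin := hlim.rpow_const (p := 1 / 2) (Or.inr (by norm_num))
  have hval : ((∫ x, ψ x ^ 2) / 2) ^ (1 / 2 : ℝ) = (1 / Real.sqrt 2) * l2Norm ⇑ψ := by
    unfold l2Norm
    rw [Real.div_rpow hpos.le (by norm_num), Real.sqrt_eq_rpow]
    ring
  rw [hval] at hfin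
  refine hfin.congr' ?_
  filter_upwards [hev, eventually_ge_atTop 1] with n hn hn1
  have ha : (1:ℝ) ≤ n := by exact_mod_cast hn1
  have ha0 : (0:ℝ) < n := by linarith
  have hN0 : 0 < (n : ℝ) ^ δ := by positivity
  have hGc : Continuous (hfnG Ψ n ((n : ℝ) ^ δ) α) := by
    unfold hfnG
    have := Ψ.continuous
    fun_prop
  obtain ⟨C, hC, hb⟩ := hfn_bound Ψ
  have hGi : ∀ φ : SchwartzMap ℝ ℂ, Integrable (fun ξ => hfnG Ψ n ((n : ℝ) ^ δ) α ξ * φ ξ) := by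
    intro φ
    refine (φ.integrable (μ := volume)).bdd_mul
      (c := ‖((((n : ℝ) ^ δ : ℝ) : ℂ) / 2)‖ * (‖Complex.exp (-(Complex.I * α))‖ * C +
        ‖Complex.exp (Complex.I * α)‖ * C)) hGc.aestronglyMeasurable
      (Eventually.of_forall fun ξ => ?_)
    unfold hfnG
    rw [norm_mul]
    gcongr
    refine (norm_add_le _ _).trans ?_
    rw [norm_mul, norm_mul]
    gcongr <;> exact hb _
  have hFT : HasFT (fun x => ψ (x / (n : ℝ) ^ δ) * Real.cos ((n : ℝ) * x - α))
      (hfnG Ψ n ((n : ℝ) ^ δ) α) := by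
    have hi : Integrable (fun x => ψ (x / (n : ℝ) ^ δ) * Real.cos ((n : ℝ) * x - α)) := by
      refine ((ψ.integrable (μ := volume)).comp_div hN0.ne').mul_bdd (c := 1) (by fun_prop)
        (Eventually.of_forall fun x => ?_)
      exact Real.abs_cos_le_one _
    have h := hfn_hasFT hi
    rwa [funext (hfn_uFT ψ (a := n) hN0 α), hΨ'] at h
  have hne : ¬ hfnG Ψ n ((n : ℝ) ^ δ) α =ᵐ[volume] 0 := by
    intro hz
    have : ∫ ξ : ℝ, (1 + ξ ^ 2) ^ r * ‖hfnG Ψ n ((n : ℝ) ^ δ) α ξ‖ ^ 2 = 0 := by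
      rw [← integral_zero ℝ ℝ]
      apply integral_congr_ae
      filter_upwards [hz] with ξ hξ
      simp [hξ]
    rw [this, mul_zero] at hn
    exact lt_irrefl _ hn
  rw [hfn_hsNorm r hGi hFT hne, Real.mul_rpow (by positivity)
    (integral_nonneg fun ξ => by positivity), ← Real.rpow_mul ha0.le]
  congr 2
  ring

/-- Let `δ > 0`, `α ∈ ℝ`, `r ≥ 0` and let `ψ` be a Schwartz function
on `ℝ`.  Then `lim_{n→∞} n^{−δ/2−r} ‖ψ(·/n^δ) cos(n·−α)‖_{H^r} = (1/√2)‖ψ‖_{L²}`,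
and the same limit holds with `cos` replaced by `sin`. -/
theorem high_frequency_norm_limit (δ : ℝ) (hδ : 0 < δ) (α r : ℝ) (hr : 0 ≤ r)
    (ψ : SchwartzMap ℝ ℝ) :
    Tendsto (fun n : ℕ => (n : ℝ) ^ (-(δ / 2) - r) *
        hsNorm r fun x => ψ (x / (n : ℝ) ^ δ) * Real.cos ((n : ℝ) * x - α))
      atTop (𝓝 ((1 / Real.sqrt 2) * l2Norm ⇑ψ)) ∧
    Tendsto (fun n : ℕ => (n : ℝ) ^ (-(δ / 2) - r) *
        hsNorm r fun x => ψ (x / (n : ℝ) ^ δ) * Real.sin ((n : ℝ) * x - α))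
      atTop (𝓝 ((1 / Real.sqrt 2) * l2Norm ⇑ψ)) := by
  refine ⟨hfn_cos δ hδ α r hr ψ, ?_⟩
  have h := hfn_cos δ hδ (α + Real.pi / 2) r hr ψ
  have e : ∀ (n : ℕ) (x : ℝ), Real.cos ((n : ℝ) * x - (α + Real.pi / 2)) =
      Real.sin ((n : ℝ) * x - α) := fun n x => by
    rw [← Real.cos_sub_pi_div_two]; congr 1; ring
  simpa only [e] using h

end
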